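/- arXiv:1204.0210 — 2 statements merged into one kernel-verified Lean document; each statement's English description precedes it below -/
import Mathlib

section
/- A finite simple graph G = (V,E) is embeddable on l columns if and only if V can be partitioned into l sets V₁, …, V_l such that each induced subgraph G[V_i] is a linear forest. -/
open SimpleGraph

/-- Cast an integer grid point to a real point. -/
def castPt {d : ℕ} (p : Fin d → ℤ) : Fin d → ℝ := fun i => (p i : ℝ)

/-- The grid points lying on the closed segment in `ℝ^d` joining `a` and `b`. -/
def segGridPts {d : ℕ} (a b : Fin d → ℤ) : Set (Fin d → ℤ) :=
  {p | castPt p ∈ segment ℝ (castPt a) (castPt b)}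

/-- `φ` is a grid drawing of `G` in `ℤ^d`: it is injective and no vertex image other than the
endpoints lies on the closed segment representing an edge. -/
def IsGridDrawing {V : Type*} {d : ℕ} (G : SimpleGraph V) (φ : V → Fin d → ℤ) : Prop :=
  Function.Injective φ ∧
    ∀ u v w : V, G.Adj u v →
      castPt (φ w) ∈ segment ℝ (castPt (φ u)) (castPt (φ v)) → w = u ∨ w = v

/-- `G` is `q`-locatable in `ℤ^d`: it has a grid drawing in which every edge segment contains
at most `q` grid points. -/
def IsQLocatable {V : Type*} (G : SimpleGraph V) (d q : ℕ) : Prop :=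
  ∃ φ : V → Fin d → ℤ, IsGridDrawing G φ ∧
    ∀ u v : V, G.Adj u v → (segGridPts (φ u) (φ v)).ncard ≤ q

/-- A primitive grid drawing: every edge segment contains exactly its two endpoints
as grid points. -/
def IsPrimitiveDrawing {V : Type*} {d : ℕ} (G : SimpleGraph V) (φ : V → Fin d → ℤ) : Prop :=
  IsGridDrawing G φ ∧ ∀ u v : V, G.Adj u v → segGridPts (φ u) (φ v) = {φ u, φ v}

/-- `G` is locatable in `ℤ^d`: it has a primitive grid drawing in `ℤ^d`. -/
def IsLocatable {V : Type*} (G : SimpleGraph V) (d : ℕ) : Prop :=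
  ∃ φ : V → Fin d → ℤ, IsPrimitiveDrawing G φ

/-- The rank of a grid point in `ℤ^d`: the tuple of its first `d - 1` coordinates. -/
def rank {d : ℕ} (p : Fin d → ℤ) : Fin (d - 1) → ℤ :=
  fun i => p (Fin.castLE (Nat.sub_le d 1) i)

/-- `G` is embeddable on `l` columns: it has a grid drawing in `ℤ²` in which the first
coordinates of the vertex images take at most `l` distinct values. -/
def EmbeddableOnCols {V : Type*} (G : SimpleGraph V) (l : ℕ) : Prop :=
  ∃ φ : V → Fin 2 → ℤ, IsGridDrawing G φ ∧ (Set.range fun v => φ v 0).ncard ≤ l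

/-- `G` can be located on `l` columns in `ℤ^d`: it has a primitive grid drawing in `ℤ^d`
using at most `l` columns. -/
def LocatableOnCols {V : Type*} (G : SimpleGraph V) (d l : ℕ) : Prop :=
  ∃ φ : V → Fin d → ℤ, IsPrimitiveDrawing G φ ∧ (Set.range fun v => rank (φ v)).ncard ≤ l

/-- A linear forest: an acyclic graph with maximum degree at most two
(i.e. a disjoint union of paths). -/
def IsLinearForest {W : Type*} (H : SimpleGraph W) : Prop :=
  H.IsAcyclic ∧ ∀ v : W, {w | H.Adj v w}.ncard ≤ 2

/-- A placement of the vertices of `H` at distinct integers such that no vertex lies between the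
endpoints of an edge. -/
def IsLinearLayout {W : Type*} (H : SimpleGraph W) (f : W → ℤ) : Prop :=
  Function.Injective f ∧ ∀ u v w : W, H.Adj u v → f u ≤ f w → f w ≤ f v → w = u ∨ w = v

namespace IsLinearLayout

variable {W : Type*} {H : SimpleGraph W} {f : W → ℤ}

lemma isAcyclic (hf : IsLinearLayout H f) : H.IsAcyclic := by
  obtain ⟨hinj, hlay⟩ := hf
  have isBridge_of_lt : ∀ u v, H.Adj u v → f u < f v → H.IsBridge s(u, v) := by
    intro u v huv hlt
    rw [isBridge_iff]
    rintro ⟨p⟩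
    obtain ⟨d, -, hd₁, hd₂⟩ := p.exists_boundary_dart {x | f x ≤ f u} (le_refl (f u)) (by simpa using hlt)
    obtain ⟨hadj, hne⟩ := deleteEdges_adj.mp d.adj
    simp only [Set.mem_ofPred_eq, not_le] at hd₁ hd₂
    have hu : d.fst = u := by
      rcases hlay _ _ u hadj hd₁ hd₂.le with h | h
      · exact h.symm
      · exact absurd (congrArg f h) hd₂.ne
    have hv : d.snd = v := by
      rcases le_total (f v) (f d.snd) with h | h
      · rcases hlay _ _ v hadj (hd₁.trans hlt.le) h with h' | h'
        · rw [h', hu] at hlt; exact absurd hlt (lt_irrefl _)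
        · exact h'.symm
      · rcases hlay _ _ d.snd huv hd₂.le h with h' | h'
        · rw [h'] at hd₂; exact absurd hd₂ (lt_irrefl _)
        · exact h'
    exact hne (by simp [hu, hv])
  rw [isAcyclic_iff_forall_adj_isBridge]
  intro u v huv
  rcases lt_trichotomy (f u) (f v) with h | h | h
  · exact isBridge_of_lt u v huv h
  · exact absurd (hinj h) huv.ne
  · rw [Sym2.eq_swap]
    exact isBridge_of_lt v u huv.symm h

lemma ncard_adj_le_two (hf : IsLinearLayout H f) (v : W) : {w | H.Adj v w}.ncard ≤ 2 := by
  obtain ⟨hinj, hlay⟩ := hf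
  have hup : {w | H.Adj v w ∧ f v < f w}.Subsingleton := by
    rintro a ⟨ha, hva⟩ b ⟨hb, hvb⟩
    rcases le_total (f a) (f b) with h | h
    · have := hlay v b a hb hva.le h; grind
    · have := hlay v a b ha hvb.le h; grind
  have hdown : {w | H.Adj v w ∧ f w < f v}.Subsingleton := by
    rintro a ⟨ha, hva⟩ b ⟨hb, hvb⟩
    rcases le_total (f a) (f b) with h | h
    · have := hlay a v b ha.symm h hvb.le; grind
    · have := hlay b v a hb.symm h hva.le; grind
  have hunion : {w | H.Adj v w} = {w | H.Adj v w ∧ f v < f w} ∪ {w | H.Adj v w ∧ f w < f v} := by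
    ext w
    have : H.Adj v w → f v ≠ f w := fun h => hinj.ne h.ne
    grind
  rw [hunion]
  refine (Set.ncard_union_le _ _).trans ?_
  have := (Set.ncard_le_one hup.finite).mpr fun _ ha _ hb => hup ha hb
  have := (Set.ncard_le_one hdown.finite).mpr fun _ ha _ hb => hdown ha hb
  omega

lemma isLinearForest (hf : IsLinearLayout H f) : IsLinearForest H :=
  ⟨hf.isAcyclic, hf.ncard_adj_le_two⟩

end IsLinearLayout

lemma SimpleGraph.IsAcyclic.exists_subsingleton_neighborSet {W : Type*} [Finite W] [Nonempty W]
    {H : SimpleGraph W} (h : H.IsAcyclic) : ∃ v, (H.neighborSet v).Subsingleton := by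
  obtain ⟨u, v, p, hp, hmax⟩ := Walk.exists_isPath_forall_isPath_length_le_length H
  have heq : ∀ w, H.Adj u w → w = p.snd := fun w hw => by
    apply h.eq_snd_of_adj_start hp hw
    by_contra hsupp
    have := hmax _ _ _ (hp.cons (h := hw.symm) hsupp)
    simp at this
  exact ⟨u, fun a ha b hb => (heq a ha).trans (heq b hb).symm⟩

lemma IsLinearForest.induce {W : Type*} [Finite W] {H : SimpleGraph W} (h : IsLinearForest H)
    (s : Set W) : IsLinearForest (H.induce s) := by
  refine ⟨h.1.induce s, fun v => ?_⟩
  rw [← Set.ncard_image_of_injective _ Subtype.val_injective]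
  refine (Set.ncard_le_ncard ?_ (Set.toFinite _)).trans (h.2 v)
  rintro _ ⟨w, hw, rfl⟩
  exact hw

/-- A vertex with at most one neighbour can be inserted into a linear layout of the rest of the
graph, next to that neighbour, on a side where the neighbour has no other neighbour. -/
lemma IsLinearForest.exists_isLinearLayout_of_induce_compl {W : Type*} [Finite W]
    {H : SimpleGraph W} (h : IsLinearForest H) {v : W} (hv : (H.neighborSet v).Subsingleton)
    {g : ({v}ᶜ : Set W) → ℤ} (hg : IsLinearLayout (H.induce {v}ᶜ) g) :
    ∃ f, IsLinearLayout H f := by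
  classical
  obtain ⟨hinj, hlay⟩ := hg
  obtain ⟨g', hg'⟩ : ∃ g' : W → ℤ, ∀ x : ({v}ᶜ : Set W), g' x = g x :=
    ⟨fun x => if hx : x ∈ ({v}ᶜ : Set W) then g ⟨x, hx⟩ else 0, fun x => by simp [x.2]⟩
  replace hinj : ∀ x y, x ≠ v → y ≠ v → g' x = g' y → x = y := fun x y hx hy hxy =>
    congrArg Subtype.val (@hinj ⟨x, hx⟩ ⟨y, hy⟩ (by rwa [← hg', ← hg']))
  replace hlay : ∀ x y z, x ≠ v → y ≠ v → z ≠ v → H.Adj x y → g' x ≤ g' z → g' z ≤ g' y →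
      z = x ∨ z = y := fun x y z hx hy hz hxy hxz hzy => by
    exact (hlay ⟨x, hx⟩ ⟨y, hy⟩ ⟨z, hz⟩ hxy (by rwa [← hg', ← hg']) (by rwa [← hg', ← hg'])).imp
      (congrArg Subtype.val) (congrArg Subtype.val)
  by_cases hiso : ∃ u, H.Adj v u
  · obtain ⟨u, huv⟩ := hiso
    have huniq : ∀ w, H.Adj v w → w = u := fun w hw => hv hw huv
    have hside : ∃ s : ℤ, (s = 1 ∨ s = -1) ∧
        ∀ w, w ≠ v → H.Adj u w → s * g' w < s * g' u := by
      have hsub : ∀ a b, a ≠ v → b ≠ v → H.Adj u a → H.Adj u b → a = b := by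
        intro a b ha hb hua hub
        by_contra hab
        have hle := h.2 u
        have hthree : ({v, a, b} : Set W).ncard = 3 := by
          rw [Set.ncard_eq_three]
          exact ⟨v, a, b, ha.symm, hb.symm, hab, rfl⟩
        have := Set.ncard_le_ncard (s := {v, a, b}) (t := {w | H.Adj u w})
          (by rintro x (rfl | rfl | rfl); exacts [huv.symm, hua, hub]) (Set.toFinite _)
        omega
      by_cases hex : ∃ w, w ≠ v ∧ H.Adj u w ∧ g' u < g' w
      · obtain ⟨w, hw, huw, hlt⟩ := hex
        refine ⟨-1, Or.inr rfl, fun a ha hua => ?_⟩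
        rw [hsub a w ha hw hua huw]
        omega
      · push Not at hex
        refine ⟨1, Or.inl rfl, fun w hw huw => ?_⟩
        have := hex w hw huw
        have : g' w ≠ g' u := fun h' => huw.ne (hinj _ _ hw huv.ne' h').symm
        omega
    obtain ⟨s, hs, hside⟩ := hside
    have hu : u ≠ v := huv.ne'
    refine ⟨fun x => if x = v then 2 * g' u + s else 2 * g' x, ?_, ?_⟩
    · intro x y hxy
      have := hinj x y
      grind
    · intro x y z hxy hxz hzy
      have := hlay x y z
      have := hlay x y u
      have := hinj u z
      have := huniq x
      have := huniq y
      have := hside x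
      have := hside y
      have := hxy.symm
      have := hxy.ne
      grind
  · push Not at hiso
    obtain ⟨M, hM⟩ := (Set.finite_range g').bddAbove
    replace hM : ∀ x, g' x ≤ M := fun x => hM ⟨x, rfl⟩
    refine ⟨fun x => if x = v then M + 1 else g' x, ?_, ?_⟩
    · intro x y hxy
      have := hinj x y
      have := hM x
      have := hM y
      grind
    · intro x y z hxy hxz hzy
      have := hlay x y z
      have := hiso x
      have := hiso y
      have := hxy.symm
      have := hM y
      grind

lemma IsLinearForest.exists_isLinearLayout {W : Type*} [Finite W] {H : SimpleGraph W}
    (h : IsLinearForest H) : ∃ f, IsLinearLayout H f := by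
  induction hn : Nat.card W generalizing W with
  | zero =>
    have := (Nat.card_eq_zero.mp hn).resolve_right (not_infinite_iff_finite.mpr inferInstance)
    exact ⟨isEmptyElim, fun x => isEmptyElim x, fun x => isEmptyElim x⟩
  | succ n ih =>
    have : Nonempty W := (Nat.card_pos_iff.mp (by omega)).1
    obtain ⟨v, hv⟩ := h.1.exists_subsingleton_neighborSet
    have hcard : Nat.card ({v}ᶜ : Set W) = n := by
      have := Set.ncard_add_ncard_compl ({v} : Set W)
      rw [Set.ncard_singleton] at this
      rw [Nat.card_coe_set_eq]
      omega
    obtain ⟨g, hg⟩ := ih (h.induce {v}ᶜ) hcard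
    exact h.exists_isLinearLayout_of_induce_compl hv hg

lemma castPt_mem_segment_iff {a b p : Fin 2 → ℤ} :
    castPt p ∈ segment ℝ (castPt a) (castPt b) ↔ ∃ s t : ℝ, 0 ≤ s ∧ 0 ≤ t ∧ s + t = 1 ∧
      s * a 0 + t * b 0 = p 0 ∧ s * a 1 + t * b 1 = p 1 := by
  simp [segment, castPt, funext_iff, Fin.forall_fin_two]

lemma castPt_mem_segment_of_column {a b p : Fin 2 → ℤ} (ha : a 0 = p 0) (hb : b 0 = p 0)
    (hap : a 1 ≤ p 1) (hpb : p 1 ≤ b 1) : castPt p ∈ segment ℝ (castPt a) (castPt b) := by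
  have h : ((p 1 : ℤ) : ℝ) ∈ segment ℝ ((a 1 : ℤ) : ℝ) ((b 1 : ℤ) : ℝ) := by
    rw [segment_eq_Icc (by exact_mod_cast hap.trans hpb)]
    exact ⟨by exact_mod_cast hap, by exact_mod_cast hpb⟩
  obtain ⟨s, t, hs, ht, hst, h⟩ := h
  refine castPt_mem_segment_iff.mpr ⟨s, t, hs, ht, hst, ?_, by simpa using h⟩
  rw [ha, hb, ← add_mul, hst, one_mul]

lemma IsGridDrawing.isLinearLayout_induce_column {V : Type*} {G : SimpleGraph V}
    {φ : V → Fin 2 → ℤ} (hφ : IsGridDrawing G φ) {s : Set V} {c : ℤ} (hs : ∀ v ∈ s, φ v 0 = c) :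
    IsLinearLayout (G.induce s) fun v => φ v 1 := by
  refine ⟨fun u v huv => Subtype.ext (hφ.1 ?_), fun u v w huv huw hwv => ?_⟩
  · ext i
    fin_cases i
    · exact (hs u u.2).trans (hs v v.2).symm
    · exact huv
  · simpa [Subtype.ext_iff] using hφ.2 u v w huv (castPt_mem_segment_of_column
      ((hs u u.2).trans (hs w w.2).symm) ((hs v v.2).trans (hs w w.2).symm) huw hwv)

/-- Integer points close to the parabola `y = N x ^ 2`, in distinct columns, are not collinear. -/
lemma eq_or_eq_of_mem_segment_near_parabola {M N : ℤ} (hMN : 2 * M < N) {i j k a b c : ℤ}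
    (hij : i ≠ j) (ha : |a| ≤ M) (hb : |b| ≤ M) (hc : |c| ≤ M) {s t : ℝ} (hs : 0 ≤ s) (ht : 0 ≤ t)
    (hst : s + t = 1) (hx : s * i + t * j = k)
    (hy : s * ((a + N * i ^ 2 : ℤ) : ℝ) + t * ((b + N * j ^ 2 : ℤ) : ℝ) =
      ((c + N * k ^ 2 : ℤ) : ℝ)) : s = 0 ∨ t = 0 := by
  by_contra! hne
  have hs' : 0 < s := hs.lt_of_ne hne.1.symm
  have ht' : 0 < t := ht.lt_of_ne hne.2.symm
  obtain rfl : s = 1 - t := by linarith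
  have hk : ((k : ℝ) - i) = t * (j - i) := by linarith
  have hprod : (((j - k) * (k - i) : ℤ) : ℝ) = (1 - t) * t * ((j : ℝ) - i) ^ 2 := by
    push_cast
    rw [← hx]
    ring
  have hji : (j : ℝ) - i ≠ 0 := sub_ne_zero.mpr (by exact_mod_cast hij.symm)
  have hpos : 0 < (j - k) * (k - i) := by
    have : (0 : ℝ) < (((j - k) * (k - i) : ℤ) : ℝ) := by rw [hprod]; positivity
    exact_mod_cast this
  have hone : (1 : ℝ) ≤ (((j - k) * (k - i) : ℤ) : ℝ) := by exact_mod_cast hpos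
  have hM : (0 : ℝ) ≤ M := by exact_mod_cast (abs_nonneg a).trans ha
  have hMN' : 2 * (M : ℝ) < N := by exact_mod_cast hMN
  have ha' : (-M : ℝ) ≤ a := by exact_mod_cast (abs_le.mp ha).1
  have hb' : (-M : ℝ) ≤ b := by exact_mod_cast (abs_le.mp hb).1
  have hc' : (c : ℝ) ≤ M := by exact_mod_cast (abs_le.mp hc).2
  have hkey : (c : ℝ) - (1 - t) * a - t * b = N * ((1 - t) * t * ((j : ℝ) - i) ^ 2) := by
    push_cast at hy
    rw [← hx] at hy
    linear_combination -hy
  rw [← hprod] at hkey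
  have h₁ : (N : ℝ) ≤ N * (((j - k) * (k - i) : ℤ) : ℝ) := le_mul_of_one_le_right (by linarith) hone
  have h₂ := mul_le_mul_of_nonneg_left ha' hs
  have h₃ := mul_le_mul_of_nonneg_left hb' ht
  linarith

/-- Linear layouts of the parts of a vertex partition, placed on consecutive columns and shifted
along a steep parabola, form a grid drawing. -/
lemma exists_isGridDrawing_of_column_layout {V : Type*} [Finite V] {G : SimpleGraph V}
    (c f : V → ℤ) (hinj : ∀ u v, c u = c v → f u = f v → u = v)
    (hlay : ∀ u v w, G.Adj u v → c u = c v → c w = c u → f u ≤ f w → f w ≤ f v →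
      w = u ∨ w = v) :
    ∃ φ : V → Fin 2 → ℤ, IsGridDrawing G φ ∧ ∀ v, φ v 0 = c v := by
  obtain ⟨M, hM⟩ := (Set.finite_range fun v => |f v|).bddAbove
  replace hM : ∀ v, |f v| ≤ M := fun v => hM ⟨v, rfl⟩
  have hφ : Function.Injective fun v => ![c v, f v + (2 * M + 1) * c v ^ 2] := by
    intro u v huv
    have h₀ : c u = c v := congrFun huv 0
    have h₁ : f u + (2 * M + 1) * c u ^ 2 = f v + (2 * M + 1) * c v ^ 2 := congrFun huv 1
    rw [h₀] at h₁
    exact hinj u v h₀ (by linarith)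
  refine ⟨fun v => ![c v, f v + (2 * M + 1) * c v ^ 2], ⟨hφ, fun u v w huv hw => ?_⟩,
    fun v => rfl⟩
  obtain ⟨s, t, hs, ht, hst, hx, hy⟩ := castPt_mem_segment_iff.mp hw
  simp only [Matrix.cons_val_zero, Matrix.cons_val_one] at hx hy
  by_cases hcol : c u = c v
  · have hcw : c w = c u := by
      rw [← hcol, ← add_mul, hst, one_mul] at hx
      exact_mod_cast hx.symm
    rw [← hcol, hcw] at hy
    push_cast at hy
    have hf : s * f u + t * f v = f w := by
      linear_combination hy - (2 * (M : ℝ) + 1) * (c u : ℝ) ^ 2 * hst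
    have hmem : (f w : ℝ) ∈ segment ℝ (f u : ℝ) (f v : ℝ) := ⟨s, t, hs, ht, hst, hf⟩
    rw [segment_eq_uIcc, Set.mem_uIcc] at hmem
    norm_cast at hmem
    rcases hmem with ⟨h₁, h₂⟩ | ⟨h₁, h₂⟩
    · exact hlay u v w huv hcol hcw h₁ h₂
    · exact (hlay v u w huv.symm hcol.symm (hcw.trans hcol) h₁ h₂).symm
  · rcases eq_or_eq_of_mem_segment_near_parabola (lt_add_one (2 * M)) hcol (hM u) (hM v) (hM w)
      hs ht hst hx hy with rfl | rfl
    · obtain rfl : t = 1 := by linarith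
      rw [zero_mul, one_mul, zero_add] at hx hy
      refine Or.inr (hφ ?_)
      norm_cast at hx hy
      beta_reduce
      rw [← hy, ← hx]
    · obtain rfl : s = 1 := by linarith
      rw [zero_mul, one_mul, add_zero] at hx hy
      refine Or.inl (hφ ?_)
      norm_cast at hx hy
      beta_reduce
      rw [← hy, ← hx]

theorem embeddableOnCols_iff_partition_linearForests {V : Type*} [Fintype V]
    (G : SimpleGraph V) (l : ℕ) :
    EmbeddableOnCols G l ↔
      ∃ P : Fin l → Set V, (∀ v : V, ∃! i, v ∈ P i) ∧
        ∀ i, IsLinearForest (G.induce (P i)) := by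
  constructor
  · rintro ⟨φ, hφ, hcard⟩
    let col (v : V) : Set.range fun v => φ v 0 := ⟨φ v 0, v, rfl⟩
    obtain ⟨e⟩ : Nonempty ((Set.range fun v => φ v 0) ↪ Fin l) := by
      rw [← Nat.card_coe_set_eq] at hcard
      exact ⟨(Finite.equivFin _).toEmbedding.trans (Fin.castLEEmb hcard)⟩
    refine ⟨fun i => {v | e (col v) = i}, fun v => ⟨_, rfl, fun i hi => hi.symm⟩, fun i => ?_⟩
    rcases Set.eq_empty_or_nonempty {v | e (col v) = i} with hempty | ⟨v₀, hv₀⟩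
    · have := Set.isEmpty_coe_sort.mpr hempty
      exact ⟨.of_subsingleton, isEmptyElim⟩
    · refine (hφ.isLinearLayout_induce_column (c := φ v₀ 0) fun v hv => ?_).isLinearForest
      exact congrArg Subtype.val (e.injective (hv.trans hv₀.symm) : col v = col v₀)
  · rintro ⟨P, hP, hforest⟩
    choose f hf using fun i => (hforest i).exists_isLinearLayout
    choose c hc huniq using hP
    have part_ext : ∀ i j u (hu : u ∈ P i) (hu' : u ∈ P j), i = j → f i ⟨u, hu⟩ = f j ⟨u, hu'⟩ := by
      rintro i _ u _ _ rfl
      rfl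
    have hcoe : ∀ u v, ((c u : ℕ) : ℤ) = (c v : ℕ) → c u = c v := fun u v h =>
      Fin.ext (by exact_mod_cast h)
    obtain ⟨φ, hφ, hcol⟩ := exists_isGridDrawing_of_column_layout (G := G)
      (fun v => ((c v : ℕ) : ℤ)) (fun v => f (c v) ⟨v, hc v⟩)
      (fun u v hcol h => by
        have hvu : c v = c u := (hcoe u v hcol).symm
        rw [part_ext _ _ v (hc v) (hvu ▸ hc v) hvu] at h
        exact congrArg Subtype.val ((hf (c u)).1 h))
      (fun u v w huv hcv hcw huw hwv => by
        have hvu : c v = c u := (hcoe u v hcv).symm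
        have hwu : c w = c u := hcoe w u hcw
        rw [part_ext _ _ w (hc w) (hwu ▸ hc w) hwu] at huw hwv
        rw [part_ext _ _ v (hc v) (hvu ▸ hc v) hvu] at hwv
        simpa only [Subtype.mk.injEq] using (hf (c u)).2 ⟨u, _⟩ ⟨v, _⟩ ⟨w, _⟩ huv huw hwv)
    refine ⟨φ, hφ, ?_⟩
    simp only [hcol]
    calc (Set.range fun v => ((c v : ℕ) : ℤ)).ncard
        ≤ (Set.range fun i : Fin l => ((i : ℕ) : ℤ)).ncard :=
          Set.ncard_le_ncard (Set.range_comp_subset_range c fun i : Fin l => ((i : ℕ) : ℤ))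
      _ ≤ l := by
          rw [← Set.image_univ]
          exact (Set.ncard_image_le).trans (by simp [Set.ncard_univ])
end

section
/- Let G = (V,E) be a finite simple graph and let d ≥ 2 and l be integers with 2^{d−1} < l ≤ 2^d. Then G can be located on l columns in ℤ^d if and only if V can be partitioned into l sets V₁, …, V_l such that each induced subgraph G[V_i] is a linear forest and at least 2l − 2^d of the parts V_i induce edgeless subgraphs (equivalently, at most 2^d − l of the induced subgraphs G[V_i] are linear forests and all remaining parts induce edgeless subgraphs). -/
open SimpleGraph

/-- A nonempty acyclic graph on a finite vertex set has a vertex with exactly one neighbour. -/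
theorem exists_leaf_of_isAcyclic {W : Type*} [Finite W] {H : SimpleGraph W} (hH : H.IsAcyclic)
    (hne : H ≠ ⊥) : ∃ u v, H.Adj u v ∧ ∀ w, H.Adj u w → w = v := by
  obtain ⟨a, b, hab⟩ := H.ne_bot_iff_exists_adj.mp hne
  have : Nonempty W := ⟨a⟩
  obtain ⟨u, v, p, hp, hmax⟩ := Walk.exists_isPath_forall_isPath_length_le_length H
  have hlen : 1 ≤ p.length := by
    simpa using hmax a b hab.toWalk (by simp [hab.ne])
  have hnil : ¬ p.Nil := by
    rw [← Walk.length_eq_zero_iff]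
    omega
  refine ⟨u, p.snd, p.adj_snd hnil, fun w hadj ↦ hH.eq_snd_of_adj_start hp hadj ?_⟩
  by_contra hw
  have := hmax _ _ _ (hp.cons (h := hadj.symm) hw)
  rw [Walk.length_cons] at this
  omega

/-- A finite linear forest can be laid out injectively on `ℤ` with adjacent vertices at
consecutive integers. -/
theorem IsLinearForest.exists_injective_consecutive {W : Type*} [Finite W]
    {H : SimpleGraph W} (hH : IsLinearForest H) :
    ∃ f : W → ℤ, Function.Injective f ∧ ∀ u v, H.Adj u v → f u = f v + 1 ∨ f v = f u + 1 := by
  induction H using WellFoundedLT.induction with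
  | ind H ih =>
  classical
  by_cases hbot : H = ⊥
  · subst hbot
    have := Fintype.ofFinite W
    exact ⟨fun w ↦ (Fintype.equivFin W w : ℕ), fun a b h ↦
      (Fintype.equivFin W).injective (Fin.ext (Nat.cast_injective h)), fun u v h ↦ h.elim⟩
  obtain ⟨u, v, huv, hleaf⟩ := exists_leaf_of_isAcyclic hH.1 hbot
  set H' := H.deleteEdges {s(u, v)} with hH'
  have hle : H' ≤ H := H.deleteEdges_le _
  have hadj (a b : W) : H'.Adj a b ↔ H.Adj a b ∧ a ≠ u ∧ b ≠ u := by
    have h1 := hleaf a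
    have h2 := hleaf b
    have h3 := huv.ne
    simp only [hH', deleteEdges_adj, Set.mem_singleton_iff, Sym2.eq_iff]
    grind [H.adj_comm]
  have hlt : H' < H := lt_of_le_of_ne hle fun h ↦ by
    rw [← h, hadj] at huv
    exact huv.2.1 rfl
  have hdeg (a b c e : W) (hb : H.Adj a b) (hc : H.Adj a c) (he : H.Adj a e) (hbc : b ≠ c)
      (hbe : b ≠ e) (hce : c ≠ e) : False := by
    have h3 : ({b, c, e} : Set W) ⊆ {w | H.Adj a w} := by
      rintro x (rfl | rfl | rfl) <;> assumption
    have := Set.ncard_le_ncard h3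
    have := hH.2 a
    rw [Set.ncard_eq_three.mpr ⟨b, c, e, hbc, hbe, hce, rfl⟩] at *
    omega
  obtain ⟨f, hf, hf1⟩ := ih H' hlt ⟨hH.1.anti hle, fun a ↦
    (Set.ncard_le_ncard fun w hw ↦ hle hw).trans (hH.2 a)⟩
  obtain ⟨g, hg, hg1, hgv⟩ : ∃ g : W → ℤ, Function.Injective g ∧
      (∀ a b, H'.Adj a b → (g a = g b + 1 ∨ g b = g a + 1)) ∧ ∀ b, H'.Adj v b → g b = g v - 1 := by
    by_cases hup : ∃ b, H'.Adj v b ∧ f b = f v + 1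
    · obtain ⟨b, hb, hfb⟩ := hup
      refine ⟨fun w ↦ - f w, fun _ _ h ↦ hf (neg_injective h), fun a c hac ↦ ?_, fun c hc ↦ ?_⟩
      · have := hf1 _ _ hac
        dsimp only
        omega
      · have hbc : b = c := by
          by_contra hne
          exact hdeg v u b c huv.symm (hle hb) (hle hc) ((hadj _ _).1 hb).2.2.symm
            ((hadj _ _).1 hc).2.2.symm hne
        subst hbc
        simp only
        omega
    · refine ⟨f, hf, hf1, fun b hb ↦ ?_⟩
      have := hf1 _ _ hb
      by_contra h
      exact hup ⟨b, hb, by omega⟩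
  refine ⟨fun w ↦ if w = u then g v + 1 else if g w ≤ g v then g w else g w + 1, ?_, ?_⟩
  · intro a b hab
    by_contra hne
    have := hg.ne hne
    grind
  · have key (a b : W) (hab : H'.Adj a b) (ha : g a ≤ g v) (hb : ¬ g b ≤ g v) : False := by
      have h1 := hg1 _ _ hab
      have : a = v := hg (by omega)
      subst this
      have := hgv _ hab
      omega
    intro a b hab
    by_cases ha : a = u
    · subst ha
      have := hleaf _ hab
      subst this
      simp [huv.ne']
    by_cases hb : b = u
    · subst hb
      have := hleaf _ hab.symm
      subst this
      simp [huv.ne']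
    have hab' := (hadj a b).2 ⟨hab, ha, hb⟩
    have h1 := hg1 _ _ hab'
    have h2 := key a b hab'
    have h3 := key b a hab'.symm
    grind

/-- A graph laid out injectively on `ℤ` with adjacent vertices at consecutive integers is a
linear forest. -/
theorem isLinearForest_of_injective_consecutive {W : Type*} {H : SimpleGraph W}
    (f : W → ℤ) (hf : Function.Injective f)
    (hf1 : ∀ u v, H.Adj u v → f u = f v + 1 ∨ f v = f u + 1) :
    IsLinearForest H := by
  classical
  refine ⟨fun a c hc ↦ ?_, fun a ↦ ?_⟩
  · obtain ⟨m, hm, hmax⟩ := c.support.toFinset.exists_max_image f ⟨a, by simp⟩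
    simp only [List.mem_toFinset] at hm hmax
    have hc' := hc.rotate hm
    have h1 := hf1 _ _ ((c.rotate m hm).adj_snd hc'.not_nil)
    have h2 := hf1 _ _ ((c.rotate m hm).adj_penultimate hc'.not_nil)
    have h3 := hmax (c.rotate m hm).snd
      ((c.mem_support_rotate_iff m hm).1 (Walk.getVert_mem_support _ _))
    have h4 := hmax (c.rotate m hm).penultimate
      ((c.mem_support_rotate_iff m hm).1 (Walk.getVert_mem_support _ _))
    exact hc'.snd_ne_penultimate (hf (by omega))
  · have hsub : f '' {w | H.Adj a w} ⊆ {f a - 1, f a + 1} := by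
      rintro _ ⟨w, hw, rfl⟩
      have := hf1 _ _ hw
      simp only [Set.mem_insert_iff, Set.mem_singleton_iff]
      omega
    rw [← Set.ncard_image_of_injective _ hf]
    exact (Set.ncard_le_ncard hsub).trans (Set.ncard_pair (by omega)).le

/-- An edgeless graph on a finite vertex set is a linear forest. -/
theorem isLinearForest_of_forall_not_adj {W : Type*} [Finite W] {H : SimpleGraph W}
    (hH : ∀ u v, ¬ H.Adj u v) : IsLinearForest H := by
  have := Fintype.ofFinite W
  exact isLinearForest_of_injective_consecutive
    (fun w ↦ (Fintype.equivFin W w : ℕ)) (fun a b h ↦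
      (Fintype.equivFin W).injective (Fin.ext (Nat.cast_injective h)))
    fun u v h ↦ (hH u v h).elim

theorem left_mem_segGridPts {d : ℕ} (a b : Fin d → ℤ) : a ∈ segGridPts a b :=
  left_mem_segment ℝ _ _

theorem right_mem_segGridPts {d : ℕ} (a b : Fin d → ℤ) : b ∈ segGridPts a b :=
  right_mem_segment ℝ _ _

/-- A segment two of whose coordinate differences are coprime is primitive. -/
theorem segGridPts_eq_pair_of_isCoprime {d : ℕ} {a b : Fin d → ℤ} (i j : Fin d)
    (h : IsCoprime (b i - a i) (b j - a j)) : segGridPts a b = {a, b} := by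
  refine Set.Subset.antisymm (fun p hp ↦ ?_) ?_
  · obtain ⟨x, y, hxy⟩ := h
    change castPt p ∈ segment ℝ (castPt a) (castPt b) at hp
    rw [segment_eq_image'] at hp
    obtain ⟨t, ⟨ht0, ht1⟩, ht⟩ := hp
    have hc (k : Fin d) : (p k : ℝ) = a k + t * (b k - a k) := by
      simpa [castPt] using (congrFun ht k).symm
    have htz : t = ((x * (p i - a i) + y * (p j - a j) : ℤ) : ℝ) := by
      have hxy' : (x : ℝ) * (b i - a i) + y * (b j - a j) = 1 := by exact_mod_cast hxy
      push_cast
      rw [hc i, hc j]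
      linear_combination -t * hxy'
    generalize x * (p i - a i) + y * (p j - a j) = s at htz
    subst htz
    have hs0 : 0 ≤ s := by exact_mod_cast ht0
    have hs1 : s ≤ 1 := by exact_mod_cast ht1
    obtain rfl | rfl : s = 0 ∨ s = 1 := by omega
    · left
      funext k
      have := hc k
      simp only [Int.cast_zero, zero_mul, add_zero] at this
      exact_mod_cast this
    · right
      funext k
      have := hc k
      simp only [Int.cast_one, one_mul, add_sub_cancel] at this
      exact_mod_cast this
  · rintro p (rfl | rfl)
    · exact left_mem_segGridPts _ _
    · exact right_mem_segGridPts _ _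

/-- If the difference of the endpoints of a nondegenerate primitive segment is a positive
multiple of an integer vector, then the factor is `1`. -/
theorem eq_one_of_segGridPts_eq_pair {d : ℕ} {a b w : Fin d → ℤ} {k : ℤ} (hab : a ≠ b)
    (h : segGridPts a b = {a, b}) (hk : 1 ≤ k) (hw : ∀ i, b i - a i = k * w i) : k = 1 := by
  have hk' : (1 : ℝ) ≤ k := by exact_mod_cast hk
  have hmem : a + w ∈ segGridPts a b := by
    change castPt (a + w) ∈ segment ℝ (castPt a) (castPt b)
    rw [segment_eq_image']
    refine ⟨(k : ℝ)⁻¹, ⟨by positivity, inv_le_one_of_one_le₀ hk'⟩, ?_⟩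
    funext i
    have hwi : (b i : ℝ) - a i = k * w i := by exact_mod_cast hw i
    simp only [castPt, Pi.add_apply, Pi.smul_apply, Pi.sub_apply, smul_eq_mul, Int.cast_add, hwi]
    field_simp
  obtain ⟨i, hi⟩ := Function.ne_iff.mp hab
  have hwi := hw i
  rw [h] at hmem
  rcases hmem with hmem | hmem
  · have := congrFun hmem i
    simp only [Pi.add_apply, add_eq_left] at this
    rw [this] at hwi
    omega
  · have := congrFun hmem i
    simp only [Pi.add_apply] at this
    have hw0 : w i ≠ 0 := by omega
    have : (k - 1) * w i = 0 := by linear_combination -hwi - this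
    have := (mul_eq_zero.mp this).resolve_right hw0
    omega

theorem eq_of_rank_eq_of_last_eq {m : ℕ} {p q : Fin (m + 1) → ℤ} (h : rank p = rank q)
    (hl : p (Fin.last m) = q (Fin.last m)) : p = q := by
  funext i
  induction i using Fin.lastCases with
  | last => exact hl
  | cast j => exact congrFun h j

/-- In a primitive drawing, adjacent vertices in a common column have consecutive last
coordinates. -/
theorem IsPrimitiveDrawing.consecutive_of_rank_eq {V : Type*} {m : ℕ} {G : SimpleGraph V}
    {φ : V → Fin (m + 1) → ℤ} (hφ : IsPrimitiveDrawing G φ) {u v : V} (huv : G.Adj u v)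
    (hr : rank (φ u) = rank (φ v)) :
    φ u (Fin.last m) = φ v (Fin.last m) + 1 ∨ φ v (Fin.last m) = φ u (Fin.last m) + 1 := by
  wlog hle : φ u (Fin.last m) ≤ φ v (Fin.last m) generalizing u v
  · exact (this huv.symm hr.symm (le_of_not_ge hle)).symm
  have hne : φ u ≠ φ v := fun h ↦ huv.ne (hφ.1.1 h)
  have hlt : φ u (Fin.last m) < φ v (Fin.last m) :=
    lt_of_le_of_ne hle fun h ↦ hne (eq_of_rank_eq_of_last_eq hr h)
  have := eq_one_of_segGridPts_eq_pair (k := φ v (Fin.last m) - φ u (Fin.last m))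
    (w := Pi.single (Fin.last m) 1) hne (hφ.2 u v huv) (by omega) fun i ↦ by
      induction i using Fin.lastCases with
      | last => simp
      | cast j =>
        rw [Pi.single_eq_of_ne (Fin.castSucc_lt_last j).ne, mul_zero, sub_eq_zero]
        exact (congrFun hr j).symm
  omega

/-- In a primitive drawing, adjacent vertices are not congruent modulo `2`. -/
theorem IsPrimitiveDrawing.not_adj_of_forall_dvd {V : Type*} {d : ℕ} {G : SimpleGraph V}
    {φ : V → Fin d → ℤ} (hφ : IsPrimitiveDrawing G φ) {u v : V}
    (h : ∀ i, (2 : ℤ) ∣ φ v i - φ u i) : ¬ G.Adj u v := by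
  intro huv
  choose w hw using h
  have := eq_one_of_segGridPts_eq_pair (fun h ↦ huv.ne (hφ.1.1 h)) (hφ.2 u v huv) (by norm_num) hw
  omega

/-- A vertex labelling with at most `l` labels, in which the classes of all but a few labels are
edgeless, yields a partition indexed by `Fin l`. -/
theorem exists_partition_of_labelling {V α : Type*} [Finite V] {G : SimpleGraph V} {l : ℕ}
    (hl : 0 < l) (g : V → α) (A B : Finset α) (hgA : ∀ v, g v ∈ A) (hA : A.card ≤ l)
    (hB : ∀ a ∈ B, IsLinearForest (G.induce {v | g v = a}))
    (hnB : ∀ u v, g u = g v → g u ∉ B → ¬ G.Adj u v) :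
    ∃ P : Fin l → Set V, (∀ v : V, ∃! i, v ∈ P i) ∧
      (∀ i, IsLinearForest (G.induce (P i))) ∧
      l - B.card ≤ {i : Fin l | ∀ u ∈ P i, ∀ v ∈ P i, ¬ G.Adj u v}.ncard := by
  classical
  have : Nonempty (Fin l) := ⟨⟨0, hl⟩⟩
  obtain ⟨e, -, he⟩ := A.finite_toSet.exists_injOn_of_encard_le
    (t := (Set.univ : Set (Fin l))) (by simpa using hA)
  have heq (u v : V) (h : e (g u) = e (g v)) : g u = g v := he (hgA u) (hgA v) h
  refine ⟨fun i ↦ {v | e (g v) = i}, fun v ↦ ⟨_, rfl, fun _ h ↦ h.symm⟩, fun i ↦ ?_, ?_⟩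
  · by_cases hi : ∃ v, e (g v) = i ∧ g v ∈ B
    · obtain ⟨v, rfl, hv⟩ := hi
      have : {w | e (g w) = e (g v)} = {w | g w = g v} :=
        Set.ext fun w ↦ ⟨heq w v, congrArg e⟩
      change IsLinearForest (G.induce {w | e (g w) = e (g v)})
      rw [this]
      exact hB _ hv
    · exact isLinearForest_of_forall_not_adj fun u v ↦ hnB u v
        (heq u v (u.2.trans v.2.symm)) fun h ↦ hi ⟨u, u.2, h⟩
  · set N := {i : Fin l | ∀ u ∈ {v | e (g v) = i}, ∀ v ∈ {v | e (g v) = i}, ¬ G.Adj u v}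
    have hN : Nᶜ ⊆ (B.image e : Finset (Fin l)) := by
      intro i hi
      by_contra hiB
      refine hi fun u hu v hv ↦ hnB u v (heq u v (hu.trans hv.symm)) fun h ↦ hiB ?_
      exact Finset.mem_coe.2 (Finset.mem_image.2 ⟨_, h, hu⟩)
    have h1 := Set.ncard_le_ncard hN
    rw [Set.ncard_coe_finset] at h1
    have h2 := Set.ncard_add_ncard_compl N
    rw [Nat.card_eq_fintype_card, Fintype.card_fin] at h2
    have h3 := B.card_image_le (f := e)
    omega

/-- For finitely many points distributed over the classes of a finite type, one may select
classes containing exactly one point so that splitting every other nonempty class in two gives at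
most `l` parts. -/
theorem exists_finset_singleton_classes {ρ κ : Type*} [Fintype κ] [DecidableEq κ] (R : Finset ρ)
    (cls : ρ → κ) {l : ℕ} (hR : R.card ≤ l) (hl : l ≤ 2 * Fintype.card κ) :
    ∃ F ⊆ R.image cls, (∀ r ∈ R, ∀ s ∈ R, cls r ∈ F → cls r = cls s → r = s) ∧
      F.card ≤ 2 * Fintype.card κ - l ∧ F.card + 2 * (R.image cls \ F).card ≤ l := by
  classical
  set S := (R.image cls).filter fun c ↦ (R.filter fun r ↦ cls r = c).card = 1
  have hS : S ⊆ R.image cls := Finset.filter_subset _ _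
  have hcount : S.card + 2 * (R.image cls \ S).card ≤ R.card := by
    rw [Finset.card_eq_sum_card_image cls R, ← Finset.sum_sdiff hS, add_comm,
      Finset.card_eq_sum_ones S, mul_comm, ← smul_eq_mul]
    refine add_le_add (Finset.card_nsmul_le_sum _ _ _ fun c hc ↦ ?_)
      (Finset.sum_le_sum fun c hc ↦ (Finset.mem_filter.1 hc).2.ge)
    rw [Finset.mem_sdiff] at hc
    have h0 : (R.filter fun r ↦ cls r = c).card ≠ 0 := by
      obtain ⟨r, hr, rfl⟩ := Finset.mem_image.1 hc.1
      exact Finset.card_ne_zero_of_mem (Finset.mem_filter.2 ⟨hr, rfl⟩)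
    have h1 : (R.filter fun r ↦ cls r = c).card ≠ 1 := fun h ↦
      hc.2 (Finset.mem_filter.2 ⟨hc.1, h⟩)
    omega
  obtain ⟨F, hFS, hF⟩ := Finset.exists_subset_card_eq
    (min_le_left S.card (2 * Fintype.card κ - l))
  refine ⟨F, hFS.trans hS, fun r hr s hs hrF hrs ↦ ?_, by omega, ?_⟩
  · have h1 := (Finset.mem_filter.1 (hFS hrF)).2
    exact Finset.card_le_one.1 h1.le r (Finset.mem_filter.2 ⟨hr, rfl⟩) s
      (Finset.mem_filter.2 ⟨hs, hrs.symm⟩)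
  · have h1 := (R.image cls).card_le_univ
    rw [Finset.card_sdiff_of_subset (hFS.trans hS)]
    rw [Finset.card_sdiff_of_subset hS] at hcount
    have h2 := Finset.card_le_card hS
    omega

theorem LocatableOnCols.exists_partition {V : Type*} [Finite V] {G : SimpleGraph V} {m l : ℕ}
    (h0 : 0 < l) (h2 : l ≤ 2 ^ (m + 1)) (h : LocatableOnCols G (m + 1) l) :
    ∃ P : Fin l → Set V, (∀ v : V, ∃! i, v ∈ P i) ∧
      (∀ i, IsLinearForest (G.induce (P i))) ∧
      2 * l - 2 ^ (m + 1) ≤ {i : Fin l | ∀ u ∈ P i, ∀ v ∈ P i, ¬ G.Adj u v}.ncard := by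
  classical
  obtain ⟨φ, hφ, hcol⟩ := h
  have hfin : (Set.range fun v ↦ rank (φ v)).Finite := Set.finite_range _
  rw [Set.ncard_eq_toFinset_card _ hfin] at hcol
  set R := hfin.toFinset
  have hR (v : V) : rank (φ v) ∈ R := hfin.mem_toFinset.2 ⟨v, rfl⟩
  let cls : (Fin m → ℤ) → Fin m → ZMod 2 := fun r j ↦ r j
  have hcard : 2 * Fintype.card (Fin m → ZMod 2) = 2 ^ (m + 1) := by
    rw [Fintype.card_fun, ZMod.card, Fintype.card_fin, pow_succ']
  obtain ⟨F, hFR, hF1, hF2, hF3⟩ := exists_finset_singleton_classes R cls hcol (hcard ▸ h2)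
  rw [hcard] at hF2
  let g : V → (Fin m → ZMod 2) × ZMod 2 := fun v ↦
    (cls (rank (φ v)), if cls (rank (φ v)) ∈ F then 0 else φ v (Fin.last m))
  have hgA (v : V) : g v ∈ F ×ˢ {0} ∪ (R.image cls \ F) ×ˢ Finset.univ := by
    have := Finset.mem_image_of_mem cls (hR v)
    by_cases hv : cls (rank (φ v)) ∈ F
    · simp [g, hv]
    · simpa [g, hv] using this
  have hA : (F ×ˢ {(0 : ZMod 2)} ∪ (R.image cls \ F) ×ˢ Finset.univ).card ≤ l := by
    refine (Finset.card_union_le _ _).trans ?_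
    rw [Finset.card_product, Finset.card_product, Finset.card_singleton, Finset.card_univ,
      ZMod.card]
    omega
  have hB (a) (ha : a ∈ F ×ˢ {(0 : ZMod 2)}) : IsLinearForest (G.induce {v | g v = a}) := by
    have hr (u v : {v | g v = a}) : rank (φ u) = rank (φ v) := by
      have hu : cls (rank (φ u)) = a.1 := congrArg Prod.fst u.2
      have hv : cls (rank (φ v)) = a.1 := congrArg Prod.fst v.2
      exact hF1 _ (hR u) _ (hR v) (hu ▸ (Finset.mem_product.1 ha).1) (hu.trans hv.symm)
    refine isLinearForest_of_injective_consecutive (fun v ↦ φ v (Fin.last m))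
      (fun u v h ↦ Subtype.ext (hφ.1.1 (eq_of_rank_eq_of_last_eq (hr u v) h)))
      fun u v huv ↦ hφ.consecutive_of_rank_eq huv (hr u v)
  have hnB (u v : V) (huv : g u = g v) (huB : g u ∉ F ×ˢ {(0 : ZMod 2)}) : ¬ G.Adj u v := by
    have hc : cls (rank (φ u)) = cls (rank (φ v)) := congrArg Prod.fst huv
    have hu : cls (rank (φ u)) ∉ F := fun h ↦ huB (by simp [g, h])
    have hz := congrArg Prod.snd huv
    simp only [g, ← hc, hu, if_false] at hz
    refine hφ.not_adj_of_forall_dvd fun i ↦ ?_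
    refine (ZMod.intCast_eq_intCast_iff_dvd_sub _ _ 2).1 ?_
    induction i using Fin.lastCases with
    | last => exact hz
    | cast j => exact congrFun hc j
  obtain ⟨P, hP1, hP2, hP3⟩ := exists_partition_of_labelling h0 g _ _ hgA hA hB hnB
  refine ⟨P, hP1, hP2, le_trans ?_ hP3⟩
  rw [Finset.card_product, Finset.card_singleton]
  omega

theorem IsLinearForest.exists_injOn_consecutive {V : Type*} [Finite V] {G : SimpleGraph V}
    {s : Set V} (hs : IsLinearForest (G.induce s)) :
    ∃ f : V → ℤ, Set.InjOn f s ∧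
      ∀ u ∈ s, ∀ v ∈ s, G.Adj u v → f u = f v + 1 ∨ f v = f u + 1 := by
  classical
  obtain ⟨f, hf, hf1⟩ := hs.exists_injective_consecutive
  refine ⟨fun v ↦ if h : v ∈ s then f ⟨v, h⟩ else 0, fun u hu v hv huv ↦ ?_,
    fun u hu v hv huv ↦ ?_⟩
  · simp only [hu, hv, dif_pos] at huv
    exact congrArg Subtype.val (hf huv)
  · simpa only [hu, hv, dif_pos] using hf1 ⟨u, hu⟩ ⟨v, hv⟩ huv

/-- If `l ≤ 2 M` and `E` has `2 l - 2 M` elements, then `Fin l` can be distributed over `M` classes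
so that distinct elements in a common class are in `E` and carry different marks. -/
theorem exists_pairing {κ : Type*} [Fintype κ] {l : ℕ} (hκ : Fintype.card κ ≤ l)
    (hl : l ≤ 2 * Fintype.card κ) (E : Finset (Fin l))
    (hE : E.card = 2 * l - 2 * Fintype.card κ) :
    ∃ (c : Fin l → κ) (b : Fin l → Bool), (∀ i, b i = true → i ∈ E) ∧
      ∀ i j, i ≠ j → c i = c j → i ∈ E ∧ j ∈ E ∧ b i ≠ b j := by
  classical
  have e₁ : E ≃ Fin (l - Fintype.card κ) × Bool := Fintype.equivOfCardEq (by simp; omega)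
  have e₂ : (Eᶜ : Finset (Fin l)) ≃ Fin (2 * Fintype.card κ - l) :=
    Fintype.equivOfCardEq (by simp; omega)
  have e₃ : Fin (l - Fintype.card κ) ⊕ Fin (2 * Fintype.card κ - l) ≃ κ :=
    Fintype.equivOfCardEq (by simp; omega)
  refine ⟨fun i ↦ e₃ (if h : i ∈ E then .inl (e₁ ⟨i, h⟩).1
      else .inr (e₂ ⟨i, Finset.mem_compl.2 h⟩)),
    fun i ↦ if h : i ∈ E then (e₁ ⟨i, h⟩).2 else false, fun i hi ↦ ?_, fun i j hij hc ↦ ?_⟩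
  · by_contra h
    simp [h] at hi
  · have hc := e₃.injective hc
    by_cases hi : i ∈ E <;> by_cases hj : j ∈ E <;>
      simp only [hi, hj, dite_true, dite_false, reduceCtorEq, Sum.inl.injEq, Sum.inr.injEq] at hc
    · refine ⟨hi, hj, fun hb ↦ hij ?_⟩
      simp only [hi, hj, dite_true] at hb
      exact congrArg Subtype.val (e₁.injective (Prod.ext hc hb))
    · exact (hij (congrArg Subtype.val (e₂.injective hc))).elim

/-- Drawing the vertices over distinct columns so that points in different columns have a pair of
coprime coordinate differences, and adjacent points in a common column are consecutive, yields a
primitive drawing. -/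
theorem locatableOnCols_of_columns {V : Type*} {m l : ℕ} {G : SimpleGraph V} (ι : V → Fin l)
    (r : Fin l → Fin m → ℤ) (z : V → ℤ)
    (hz : ∀ u v, ι u = ι v → z u = z v → u = v)
    (hadj : ∀ u v, ι u = ι v → G.Adj u v → z u = z v + 1 ∨ z v = z u + 1)
    (hcop : ∀ u v, ι u ≠ ι v → (∃ j, IsCoprime (r (ι v) j - r (ι u) j) (r (ι v) j - r (ι u) j)) ∨
      ∃ j, IsCoprime (r (ι v) j - r (ι u) j) (z v - z u)) :
    LocatableOnCols G (m + 1) l := by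
  let φ : V → Fin (m + 1) → ℤ := fun v ↦ Fin.snoc (α := fun _ ↦ ℤ) (r (ι v)) (z v)
  have hcs (v : V) (j : Fin m) : φ v j.castSucc = r (ι v) j := Fin.snoc_castSucc ..
  have hlast (v : V) : φ v (Fin.last m) = z v := Fin.snoc_last ..
  have hrank (v : V) : rank (φ v) = r (ι v) := funext (hcs v)
  have hcop' (u v : V) (h : ι u ≠ ι v) :
      ∃ i j, IsCoprime (φ v i - φ u i) (φ v j - φ u j) := by
    rcases hcop u v h with ⟨j, hj⟩ | ⟨j, hj⟩
    · exact ⟨j.castSucc, j.castSucc, by simpa only [hcs] using hj⟩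
    · exact ⟨j.castSucc, Fin.last m, by simpa only [hcs, hlast] using hj⟩
  have hinj : Function.Injective φ := by
    intro u v huv
    by_cases h : ι u = ι v
    · exact hz u v h (by rw [← hlast, ← hlast, huv])
    · obtain ⟨i, j, hij⟩ := hcop' u v h
      rw [huv, sub_self, sub_self] at hij
      exact (not_isCoprime_zero_zero hij).elim
  have hprim (u v : V) (huv : G.Adj u v) : segGridPts (φ u) (φ v) = {φ u, φ v} := by
    by_cases h : ι u = ι v
    · refine segGridPts_eq_pair_of_isCoprime (Fin.last m) (Fin.last m) ?_
      rw [hlast, hlast, isCoprime_self, Int.isUnit_iff]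
      have := hadj u v h huv
      omega
    · obtain ⟨i, j, hij⟩ := hcop' u v h
      exact segGridPts_eq_pair_of_isCoprime i j hij
  refine ⟨φ, ⟨⟨hinj, fun u v w huv hw ↦ ?_⟩, hprim⟩, ?_⟩
  · have hw' : φ w ∈ segGridPts (φ u) (φ v) := hw
    rw [hprim u v huv] at hw'
    exact hw'.imp (fun h ↦ hinj h) fun h ↦ hinj h
  · simp only [hrank]
    refine (Set.ncard_le_ncard (Set.range_comp_subset_range ι r)).trans ?_
    rw [← Set.image_univ]
    refine (Set.ncard_image_le).trans ?_
    rw [Set.ncard_univ, Nat.card_eq_fintype_card, Fintype.card_fin]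

theorem isCoprime_two_of_odd {x y : ℤ} (hx : x = 2 ∨ x = -2) (hy : y % 2 = 1) : IsCoprime x y := by
  have h : IsCoprime (2 : ℤ) y := ⟨-(y / 2), 1, by omega⟩
  rcases hx with rfl | rfl
  · exact h
  · exact h.neg_left

theorem isCoprime_three_of_not_dvd {x y : ℤ} (hx : x = 3 ∨ x = -3) (hy : y % 3 ≠ 0) :
    IsCoprime x y := by
  have h : IsCoprime (3 : ℤ) y := by
    obtain h | h : y % 3 = 1 ∨ y % 3 = 2 := by omega
    · exact ⟨-(y / 3), 1, by omega⟩
    · exact ⟨y / 3 + 1, -1, by omega⟩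
  rcases hx with rfl | rfl
  · exact h
  · exact h.neg_left

theorem locatableOnCols_of_partition {V : Type*} [Finite V] {G : SimpleGraph V} {n l : ℕ}
    (h1 : 2 ^ (n + 1) ≤ l) (h2 : l ≤ 2 ^ (n + 2)) (P : Fin l → Set V)
    (hP : ∀ v : V, ∃ i, v ∈ P i) (hlin : ∀ i, IsLinearForest (G.induce (P i)))
    (hE : 2 * l - 2 ^ (n + 2) ≤ {i : Fin l | ∀ u ∈ P i, ∀ v ∈ P i, ¬ G.Adj u v}.ncard) :
    LocatableOnCols G (n + 2) l := by
  classical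
  have hcard : Fintype.card (Fin (n + 1) → Bool) = 2 ^ (n + 1) := by simp
  have hpow : 2 ^ (n + 2) = 2 * 2 ^ (n + 1) := pow_succ' 2 (n + 1)
  obtain ⟨E, hEsub, hEcard⟩ := Set.exists_subset_card_eq hE
  rw [Set.ncard_eq_toFinset_card'] at hEcard
  obtain ⟨c, b, hb, hcb⟩ := exists_pairing (κ := Fin (n + 1) → Bool) (hcard ▸ h1)
    (by omega) E.toFinset (by omega)
  simp only [Set.mem_toFinset] at hb hcb
  choose ι hι using hP
  choose f hf hf1 using fun i ↦ (hlin i).exists_injOn_consecutive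
  have hidx : ∃ idx : V → ℤ, Function.Injective idx :=
    have := Fintype.ofFinite V
    ⟨fun w ↦ (Fintype.equivFin V w : ℕ), fun a b h ↦
      (Fintype.equivFin V).injective (Fin.ext (Nat.cast_injective h))⟩
  obtain ⟨idx, hidx⟩ := hidx
  refine locatableOnCols_of_columns ι
    (fun i j ↦ if b i = true ∧ j = 0 then (if c i 0 then -1 else 2) else if c i j then 1 else 0)
    (fun v ↦ if ι v ∈ E then
      (if b (ι v) then (if c (ι v) 0 then 6 * idx v + 1 else 6 * idx v + 3) else 2 * idx v)
      else f (ι v) v) (fun u v huv h ↦ ?_) (fun u v huv h ↦ ?_) fun u v huv ↦ ?_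
  · simp only [huv] at h
    have := hf (ι v) (huv ▸ hι u) (hι v)
    have := @hidx u v
    grind
  · by_cases hE' : ι v ∈ E
    · exact (hEsub hE' u (huv ▸ hι u) v (hι v) h).elim
    · simp only [huv, hE', if_false]
      exact hf1 (ι v) u (huv ▸ hι u) v (hι v) h
  · by_cases hc : c (ι u) = c (ι v)
    · obtain ⟨hu, hv, hbuv⟩ := hcb _ _ huv hc
      refine Or.inr ⟨0, isCoprime_two_of_odd ?_ ?_⟩
      · grind
      · grind
    obtain ⟨j, hj⟩ := Function.ne_iff.mp hc
    by_cases hj0 : j = 0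
    · subst hj0
      by_cases hbb : b (ι u) = true ∧ b (ι v) = true
      · refine Or.inr ⟨0, isCoprime_three_of_not_dvd ?_ ?_⟩
        · grind
        · have := hb _ hbb.1
          have := hb _ hbb.2
          grind
      · refine Or.inl ⟨0, ?_⟩
        rw [isCoprime_self, Int.isUnit_iff]
        grind
    · refine Or.inl ⟨j, ?_⟩
      rw [isCoprime_self, Int.isUnit_iff]
      grind

theorem locatableOnCols_iff_partition {V : Type*} [Fintype V] (G : SimpleGraph V)
    (d l : ℕ) (hd : 2 ≤ d) (h1 : 2 ^ (d - 1) < l) (h2 : l ≤ 2 ^ d) :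
    LocatableOnCols G d l ↔
      ∃ P : Fin l → Set V, (∀ v : V, ∃! i, v ∈ P i) ∧
        (∀ i, IsLinearForest (G.induce (P i))) ∧
        2 * l - 2 ^ d ≤ {i : Fin l | ∀ u ∈ P i, ∀ v ∈ P i, ¬ G.Adj u v}.ncard := by
  obtain ⟨n, rfl⟩ := Nat.exists_eq_add_of_le' hd
  exact ⟨fun h ↦ h.exists_partition (Nat.zero_lt_of_lt h1) h2, fun ⟨P, hP, hlin, hE⟩ ↦
    locatableOnCols_of_partition h1.le h2 P (fun v ↦ (hP v).exists) hlin hE⟩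
end
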